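/- Let d ≥ 1, let Ω ⊆ ℝ^d be an open, bounded, connected nonempty set, let μ be a Borel probability measure on ℝ^d, let p > 0 with p ≠ 1, and let k > 0. Let P and Q be Borel probability measures on ℝ^d concentrated on Ω (i.e. P(ℝ^d \ Ω) = Q(ℝ^d \ Ω) = 0). Then P = Q if and only if L_{P,Q,μ,p,k}(f) ≥ 0 for every admissible f. (This is the full identity-of-indiscernibles statement of Theorem 1: the Wasserstein divergence W'_{p,k}(P, Q) is zero exactly when P = Q, and strictly negative otherwise.) -/

import Mathlib

open MeasureTheory

/-- A function `f : ℝ^d → ℝ` is admissible for `Ω` if it is C¹ and has compact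
support contained in `Ω`. -/
def Admissible {d : ℕ} (Ω : Set (EuclideanSpace ℝ (Fin d)))
    (f : EuclideanSpace ℝ (Fin d) → ℝ) : Prop :=
  ContDiff ℝ 1 f ∧ HasCompactSupport f ∧ tsupport f ⊆ Ω

/-- The Wasserstein-divergence objective
`L_{P,Q,μ,p,k}(f) = ∫ f dP − ∫ f dQ + k ∫ ‖Df(x)‖^p dμ(x)`. -/
noncomputable def Lobj {d : ℕ} (P Q μ : Measure (EuclideanSpace ℝ (Fin d)))
    (p k : ℝ) (f : EuclideanSpace ℝ (Fin d) → ℝ) : ℝ :=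
  ∫ x, f x ∂P - ∫ x, f x ∂Q + k * ∫ x, ‖fderiv ℝ f x‖ ^ p ∂μ

/-- If `t * a + t ^ p * b ≥ 0` for all `t > 0` and `p ≠ 1`, then `a ≥ 0`. -/
lemma nonneg_of_forall_mul_add_rpow_mul_nonneg {a b p : ℝ} (hp1 : p ≠ 1)
    (h : ∀ t : ℝ, 0 < t → 0 ≤ t * a + t ^ p * b) : 0 ≤ a := by
  have key : ∀ t : ℝ, 0 < t → 0 ≤ a + t ^ (p - 1) * b := by
    intro t ht
    have h1 := h t ht
    rw [show t ^ p = t * t ^ (p - 1) by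
      rw [Real.rpow_sub_one ht.ne']; field_simp, mul_assoc, ← mul_add] at h1
    exact nonneg_of_mul_nonneg_right h1 ht
  have key' : ∀ s : ℝ, 0 < s → 0 ≤ a + s * b := by
    intro s hs
    have h1 := key (s ^ (p - 1)⁻¹) (Real.rpow_pos_of_pos hs _)
    rwa [← Real.rpow_mul hs.le, inv_mul_cancel₀ (sub_ne_zero.2 hp1), Real.rpow_one] at h1
  have lim : Filter.Tendsto (fun s : ℝ => a + s * b) (nhdsWithin 0 (Set.Ioi 0)) (nhds a) := by
    have hc : Continuous fun s : ℝ => a + s * b := by fun_prop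
    simpa using (hc.tendsto 0).mono_left nhdsWithin_le_nhds
  exact ge_of_tendsto lim (Filter.eventually_of_mem self_mem_nhdsWithin key')

/-- Finite measures concentrated on an open set are equal if they integrate smooth functions
compactly supported in this set equally. -/
lemma measure_eq_of_integral_contDiff_eq {E : Type*} [NormedAddCommGroup E] [NormedSpace ℝ E]
    [FiniteDimensional ℝ E] [MeasurableSpace E] [BorelSpace E] {U : Set E} (hU : IsOpen U)
    (P Q : Measure E) [IsFiniteMeasure P] [IsFiniteMeasure Q] (hP : P Uᶜ = 0) (hQ : Q Uᶜ = 0)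
    (h : ∀ f : E → ℝ, ContDiff ℝ (⊤ : ℕ∞) f → HasCompactSupport f → tsupport f ⊆ U →
      ∫ x, f x ∂P = ∫ x, f x ∂Q) : P = Q := by
  obtain ⟨ν, hν⟩ : ∃ ν, ν = P + Q := ⟨_, rfl⟩
  have : IsFiniteMeasure ν := hν ▸ inferInstance
  have hPν : P ≪ ν := hν ▸ Measure.absolutelyContinuous_of_le (Measure.le_add_right le_rfl)
  have hQν : Q ≪ ν := hν ▸ Measure.absolutelyContinuous_of_le (Measure.le_add_left le_rfl)
  have hUae : ∀ᵐ x ∂ν, x ∈ U := by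
    have hνU : ν Uᶜ = 0 := by simp [hν, hP, hQ]
    exact mem_ae_iff.2 hνU
  clear hν
  have hPi : Integrable (fun x => (P.rnDeriv ν x).toReal) ν := Measure.integrable_toReal_rnDeriv
  have hQi : Integrable (fun x => (Q.rnDeriv ν x).toReal) ν := Measure.integrable_toReal_rnDeriv
  have hint : ∀ g : E → ℝ, ContDiff ℝ (⊤ : ℕ∞) g → HasCompactSupport g → tsupport g ⊆ U →
      ∫ x, g x • ((P.rnDeriv ν x).toReal - (Q.rnDeriv ν x).toReal) ∂ν = 0 := by
    intro g hg hgc hgs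
    obtain ⟨C, hC⟩ := hgc.exists_bound_of_continuous hg.continuous
    have hm : AEStronglyMeasurable g ν := hg.continuous.aestronglyMeasurable
    have hPg : Integrable (fun x => (P.rnDeriv ν x).toReal • g x) ν :=
      hPi.mul_bdd hm (Filter.Eventually.of_forall hC)
    have hQg : Integrable (fun x => (Q.rnDeriv ν x).toReal • g x) ν :=
      hQi.mul_bdd hm (Filter.Eventually.of_forall hC)
    calc
      _ = ∫ x, (P.rnDeriv ν x).toReal • g x - (Q.rnDeriv ν x).toReal • g x ∂ν := by
        congr with x
        simp only [smul_eq_mul]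
        ring
      _ = 0 := by
        rw [integral_sub hPg hQg, integral_rnDeriv_smul hPν, integral_rnDeriv_smul hQν,
          h g hg hgc hgs, sub_self]
  have hloc : LocallyIntegrableOn
      (fun x => (P.rnDeriv ν x).toReal - (Q.rnDeriv ν x).toReal) U ν :=
    (hPi.sub hQi).locallyIntegrable.locallyIntegrableOn U
  have hae := hU.ae_eq_zero_of_integral_contDiff_smul_eq_zero hloc hint
  rw [← Measure.withDensity_rnDeriv_eq P ν hPν, ← Measure.withDensity_rnDeriv_eq Q ν hQν]
  refine withDensity_congr_ae ?_
  filter_upwards [hae, hUae, P.rnDeriv_lt_top ν, Q.rnDeriv_lt_top ν] with x hx hxU hxP hxQ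
  exact (ENNReal.toReal_eq_toReal_iff' hxP.ne hxQ.ne).1 (sub_eq_zero.1 (hx hxU))

lemma Admissible.const_mul {d : ℕ} {Ω : Set (EuclideanSpace ℝ (Fin d))}
    {f : EuclideanSpace ℝ (Fin d) → ℝ} (hf : Admissible Ω f) (t : ℝ) :
    Admissible Ω (fun x => t * f x) :=
  ⟨contDiff_const.mul hf.1, hf.2.1.mul_left, (tsupport_mul_subset_right).trans hf.2.2⟩

lemma Lobj_const_mul {d : ℕ} (P Q μ : Measure (EuclideanSpace ℝ (Fin d))) (p k : ℝ)
    {f : EuclideanSpace ℝ (Fin d) → ℝ} (hf : Differentiable ℝ f) {t : ℝ} (ht : 0 ≤ t) :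
    Lobj P Q μ p k (fun x => t * f x) =
      t * (∫ x, f x ∂P - ∫ x, f x ∂Q) + t ^ p * (k * ∫ x, ‖fderiv ℝ f x‖ ^ p ∂μ) := by
  have e : ∀ x, ‖fderiv ℝ (fun x => t * f x) x‖ ^ p = t ^ p * ‖fderiv ℝ f x‖ ^ p := by
    intro x
    rw [fderiv_const_mul (hf x), norm_smul, Real.norm_of_nonneg ht,
      Real.mul_rpow ht (norm_nonneg _)]
  simp only [Lobj, e, integral_const_mul]
  ring

theorem stmt4 {d : ℕ} (hd : 1 ≤ d) (Ω : Set (EuclideanSpace ℝ (Fin d)))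
    (hΩopen : IsOpen Ω) (hΩbdd : Bornology.IsBounded Ω)
    (hΩconn : IsConnected Ω) (hΩne : Ω.Nonempty)
    (P Q μ : Measure (EuclideanSpace ℝ (Fin d)))
    [IsProbabilityMeasure P] [IsProbabilityMeasure Q] [IsProbabilityMeasure μ]
    (p k : ℝ) (hp : 0 < p) (hp1 : p ≠ 1) (hk : 0 < k)
    (hP : P Ωᶜ = 0) (hQ : Q Ωᶜ = 0) :
    P = Q ↔ ∀ f, Admissible Ω f → 0 ≤ Lobj P Q μ p k f := by
  constructor
  · rintro rfl f -
    rw [Lobj, sub_self, zero_add]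
    exact mul_nonneg hk.le (integral_nonneg fun x => Real.rpow_nonneg (norm_nonneg _) p)
  · intro h
    have hle : ∀ f, Admissible Ω f → 0 ≤ ∫ x, f x ∂P - ∫ x, f x ∂Q := fun f hf =>
      nonneg_of_forall_mul_add_rpow_mul_nonneg hp1 fun t ht => by
        rw [← Lobj_const_mul P Q μ p k (hf.1.differentiable one_ne_zero) ht.le]
        exact h _ (hf.const_mul t)
    refine measure_eq_of_integral_contDiff_eq hΩopen P Q hP hQ fun f hf hfc hfs => ?_
    have hadm : Admissible Ω f := ⟨hf.of_le (mod_cast le_top), hfc, hfs⟩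
    have h1 := hle f hadm
    have h2 := hle _ (hadm.const_mul (-1))
    simp only [integral_const_mul] at h2
    linarith
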